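/- arXiv:2408.06233 — 2 statements merged into one kernel-verified Lean document; each statement's English description precedes it below -/
import Mathlib

section
/- Let $K$ be a field of infinite transcendence degree over $\mathbb{Q}$. Then the Milnor K-group $K^M_n(K)$ (for $n \ge 2$) has cardinality at most $\mathrm{card}(K)$, and if $K^M_n$ of suitable subfields injects compatibly, the rank of $K^M_2(K) \otimes \mathbb{Q}$ equals $\mathrm{card}(K)$. In particular, $K^M_2(\mathbb{R}) \otimes \mathbb{Q}$ is an uncountable $\mathbb{Q}$-vector space. -/
open scoped TensorProduct

/-- The subgroup of relations defining Milnor K-theory: multilinearity and the Steinberg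
relation. -/
def milnorRel (n : ℕ) (K : Type) [CommRing K] :
    AddSubgroup (FreeAbelianGroup (Fin n → Kˣ)) :=
  AddSubgroup.closure
    ({x | ∃ (u : Fin n → Kˣ) (i : Fin n) (s t : Kˣ), u i = s * t ∧
        x = FreeAbelianGroup.of u - FreeAbelianGroup.of (Function.update u i s) -
          FreeAbelianGroup.of (Function.update u i t)} ∪
     {x | ∃ (u : Fin n → Kˣ) (i j : Fin n), i ≠ j ∧ ((u i : K) + (u j : K) = 1) ∧
        x = FreeAbelianGroup.of u})

/-- The `n`-th Milnor K-group of `K`: the quotient of the free abelian group on `n`-tuples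
of units by multilinearity and the Steinberg relation. -/
def MilnorK (n : ℕ) (K : Type) [CommRing K] : Type :=
  FreeAbelianGroup (Fin n → Kˣ) ⧸ milnorRel n K

instance (n : ℕ) (K : Type) [CommRing K] : AddCommGroup (MilnorK n K) :=
  QuotientAddGroup.Quotient.addCommGroup _

/-- The symbol `{u 0, …, u (n-1)}` in Milnor K-theory. -/
def MilnorK.symbol {n : ℕ} {K : Type} [CommRing K] (u : Fin n → Kˣ) : MilnorK n K :=
  QuotientAddGroup.mk (FreeAbelianGroup.of u)

open Cardinal KaehlerDifferential

/-- In characteristic zero, a field is formally étale over the polynomial ring on a transcendence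
basis. -/
theorem IsTranscendenceBasis.formallyEtale {k L ι : Type*} [Field k] [CharZero k] [Field L]
    [Algebra k L] {v : ι → L} (hv : IsTranscendenceBasis k v)
    [Algebra (MvPolynomial ι k) L]
    (hmap : algebraMap (MvPolynomial ι k) L = (MvPolynomial.aeval v : _ →ₐ[k] L)) :
    Algebra.FormallyEtale (MvPolynomial ι k) L := by
  have hinj : Function.Injective (algebraMap (MvPolynomial ι k) L) := by
    rw [hmap]; exact hv.1
  have : FaithfulSMul (MvPolynomial ι k) L := (faithfulSMul_iff_algebraMap_injective _ _).2 hinj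
  let F := FractionRing (MvPolynomial ι k)
  let : Algebra F L := FractionRing.liftAlgebra _ L
  have : CharZero F := charZero_of_injective_algebraMap (FaithfulSMul.algebraMap_injective k F)
  have : Algebra.IsAlgebraic (MvPolynomial ι k) L := by
    have := hv.isAlgebraic
    refine Algebra.IsAlgebraic.of_ringHom_of_comp_eq hv.1.aevalEquiv
      (RingHom.id L) hv.1.aevalEquiv.surjective Function.injective_id ?_
    ext p <;> simp [hmap]
  have : Algebra.IsAlgebraic F L :=
    (IsFractionRing.comap_isAlgebraic_iff (A := MvPolynomial ι k)).1 ‹_›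
  have : Algebra.FormallyEtale (MvPolynomial ι k) F := .of_isLocalization (nonZeroDivisors _)
  have : Algebra.FormallyEtale F L := .of_isSeparable F L
  exact .comp _ F _

/-- In characteristic zero, the differentials of a transcendence basis form a basis of the Kähler
differentials. -/
theorem IsTranscendenceBasis.exists_basis_kaehlerDifferential {k L ι : Type*} [Field k]
    [CharZero k] [Field L] [Algebra k L] {v : ι → L} (hv : IsTranscendenceBasis k v) :
    ∃ b : Module.Basis ι L Ω[L⁄k], ∀ i, b i = D k L (v i) := by
  let : Algebra (MvPolynomial ι k) L := (MvPolynomial.aeval v : _ →ₐ[k] L).toRingHom.toAlgebra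
  have : IsScalarTower k (MvPolynomial ι k) L :=
    .of_algebraMap_eq fun x ↦ ((MvPolynomial.aeval v : _ →ₐ[k] L).commutes x).symm
  have := hv.formallyEtale rfl
  refine ⟨((mvPolynomialBasis k ι).baseChange L).map
    (tensorKaehlerEquivOfFormallyEtale k (MvPolynomial ι k) L), fun i ↦ ?_⟩
  have : algebraMap (MvPolynomial ι k) L (.X i) = v i := MvPolynomial.aeval_X v i
  simp [this]

/-- In characteristic zero, there are partial derivatives with respect to a transcendence basis. -/
theorem IsTranscendenceBasis.exists_derivation {k L ι : Type*} [Field k]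
    [CharZero k] [Field L] [Algebra k L] {v : ι → L} (hv : IsTranscendenceBasis k v)
    [DecidableEq ι] :
    ∃ d : ι → Derivation k L L, ∀ i j, d i (v j) = if i = j then 1 else 0 := by
  obtain ⟨b, hb⟩ := hv.exists_basis_kaehlerDifferential
  refine ⟨fun i ↦ (b.coord i).compDer (D k L), fun i j ↦ ?_⟩
  change b.repr (D k L (v j)) i = _
  rw [← hb, b.repr_self, Finsupp.single_apply]
  simp only [eq_comm]

namespace MilnorK

/-- The value of the form `dlog a ∧ dlog b` on a pair of derivations. -/
noncomputable def dlogWedge {k K : Type} [CommRing k] [Field K] [Algebra k K]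
    (d e : Derivation k K K) (u : Fin 2 → Kˣ) : K :=
  (d (u 0) * e (u 1) - e (u 0) * d (u 1)) / (u 0 * u 1)

/-- The homomorphism `{a, b} ↦ dlog a ∧ dlog b`, evaluated on a pair of derivations. -/
noncomputable def dlogHom {k K : Type} [CommRing k] [Field K] [Algebra k K]
    (d e : Derivation k K K) : MilnorK 2 K →+ K :=
  QuotientAddGroup.lift (milnorRel 2 K) (FreeAbelianGroup.lift (dlogWedge d e)) <| by
    rw [milnorRel, AddSubgroup.closure_le]
    rintro x (⟨u, i, s, t, h, rfl⟩ | ⟨u, i, j, hij, h, rfl⟩)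
    · have hs := s.ne_zero
      have ht := t.ne_zero
      have h0 := (u 0).ne_zero
      have h1 := (u 1).ne_zero
      simp only [SetLike.mem_coe, AddMonoidHom.mem_ker, map_sub, FreeAbelianGroup.lift_apply_of,
        dlogWedge]
      fin_cases i
      · simp only [Fin.zero_eta] at h
        simp [h, Derivation.leibniz]
        field_simp
        ring
      · simp only [Fin.mk_one] at h
        simp [h, Derivation.leibniz]
        field_simp
        ring
    · have hd : d (u i) + d (u j) = 0 := by rw [← map_add, h, d.map_one_eq_zero]
      have he : e (u i) + e (u j) = 0 := by rw [← map_add, h, e.map_one_eq_zero]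
      rw [add_eq_zero_iff_eq_neg] at hd he
      simp only [SetLike.mem_coe, AddMonoidHom.mem_ker, FreeAbelianGroup.lift_apply_of, dlogWedge]
      fin_cases i <;> fin_cases j <;> simp_all [mul_comm]

@[simp]
theorem dlogHom_symbol {k K : Type} [CommRing k] [Field K] [Algebra k K]
    (d e : Derivation k K K) (u : Fin 2 → Kˣ) : dlogHom d e (symbol u) = dlogWedge d e u := by
  change FreeAbelianGroup.lift (dlogWedge d e) (FreeAbelianGroup.of u) = _
  simp

theorem cardinalMk_units_tuple_le (n : ℕ) (K : Type) [Field K] [Infinite K] : #(Fin n → Kˣ) ≤ #K := by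
  calc #(Fin n → Kˣ) ≤ #(Fin n → K) :=
        mk_le_of_injective (Units.val_injective.comp_left : Function.Injective _)
    _ = #K ^ n := by simp
    _ ≤ #K := power_nat_le (aleph0_le_mk K)

theorem cardinalMk_le (n : ℕ) (K : Type) [Field K] [Infinite K] : #(MilnorK n K) ≤ #K := by
  refine (mk_le_of_surjective (QuotientAddGroup.mk_surjective (s := milnorRel n K))).trans ?_
  rw [mk_freeAbelianGroup]
  exact max_le (cardinalMk_units_tuple_le n K) (aleph0_le_mk K)

theorem span_symbol (n : ℕ) (K : Type) [Field K] :
    Submodule.span ℚ (Set.range fun u : Fin n → Kˣ ↦ (1 : ℚ) ⊗ₜ[ℤ] (symbol u : MilnorK n K)) =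
      ⊤ := by
  refine Submodule.eq_top_iff'.2 fun x ↦ ?_
  induction x with
  | zero => exact zero_mem _
  | add x y hx hy => exact add_mem hx hy
  | tmul q m =>
    rw [← mul_one q, ← smul_eq_mul, ← TensorProduct.smul_tmul']
    refine Submodule.smul_mem _ _ ?_
    obtain ⟨m, rfl⟩ := QuotientAddGroup.mk_surjective (s := milnorRel n K) m
    let f : FreeAbelianGroup (Fin n → Kˣ) →+ ℚ ⊗[ℤ] MilnorK n K :=
      (TensorProduct.mk ℤ ℚ (MilnorK n K) 1).toAddMonoidHom.comp
        (QuotientAddGroup.mk' (milnorRel n K))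
    change f m ∈ _
    induction m using FreeAbelianGroup.induction_on with
    | zero => exact map_zero f ▸ zero_mem _
    | of u => exact Submodule.subset_span ⟨u, rfl⟩
    | neg u h => exact map_neg f _ ▸ neg_mem h
    | add x y hx hy => exact map_add f x y ▸ add_mem hx hy

theorem rank_le (n : ℕ) (K : Type) [Field K] [Infinite K] :
    Module.rank ℚ (ℚ ⊗[ℤ] MilnorK n K) ≤ #K := by
  rw [← rank_top, ← span_symbol]
  exact (rank_span_le _).trans (mk_range_le.trans (cardinalMk_units_tuple_le n K))

/-- The symbols `{v o, v i}`, for `v` a transcendence basis and `i ≠ o`, are independent. -/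
theorem linearIndependent_symbol {K ι : Type} [Field K] [CharZero K] {v : ι → Kˣ}
    (hv : IsTranscendenceBasis ℚ fun i ↦ (v i : K)) (o : ι) :
    LinearIndependent ℚ fun i : ({o}ᶜ : Set ι) ↦ (1 : ℚ) ⊗ₜ[ℤ] symbol ![v o, v i] := by
  classical
  obtain ⟨d, hd⟩ := hv.exists_derivation
  let ℓ (i : ({o}ᶜ : Set ι)) : ℚ ⊗[ℤ] MilnorK 2 K →ₗ[ℚ] K :=
    TensorProduct.AlgebraTensorModule.lift
      (LinearMap.toSpanSingleton ℚ _ (dlogHom (d o) (d i)).toIntLinearMap)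
  have hℓ (i j : ({o}ᶜ : Set ι)) : ℓ j ((1 : ℚ) ⊗ₜ[ℤ] symbol ![v o, v i]) =
      Pi.single (M := fun _ ↦ K) i ((v o : K) * v i)⁻¹ j := by
    have hi : o ≠ i := fun h ↦ i.2 h.symm
    simp only [ℓ, TensorProduct.AlgebraTensorModule.lift_tmul, LinearMap.toSpanSingleton_apply,
      one_smul, AddMonoidHom.coe_toIntLinearMap, dlogHom_symbol, dlogWedge]
    by_cases hij : j = i <;> simp [hd, hi, hij, Subtype.coe_inj]
  refine .of_comp (LinearMap.pi ℓ) ?_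
  have hcomp : (LinearMap.pi ℓ ∘ fun i : ({o}ᶜ : Set ι) ↦ (1 : ℚ) ⊗ₜ[ℤ] symbol ![v o, v i]) =
      fun i : ({o}ᶜ : Set ι) ↦ Pi.single (M := fun _ ↦ K) i ((v o : K) * v i)⁻¹ := by
    ext i j
    exact hℓ i j
  rw [hcomp]
  exact Pi.linearIndependent_single_of_ne_zero (R := ℚ) (M := K) fun i ↦ by simp

theorem rank_eq (K : Type) [Field K] [CharZero K]
    (htr : ∃ s : Set K, s.Infinite ∧ AlgebraicIndependent ℚ ((↑) : s → K)) :
    Module.rank ℚ (ℚ ⊗[ℤ] MilnorK 2 K) = #K := by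
  have : Infinite K := CharZero.infinite K
  refine (rank_le 2 K).antisymm ?_
  obtain ⟨s, hs, hind⟩ := htr
  obtain ⟨B, hsB, hB⟩ := exists_isTranscendenceBasis_superset hind
  have : Infinite B := (hs.mono hsB).to_subtype
  obtain ⟨o⟩ := (inferInstance : Nonempty B)
  have hcard : #K = #B := by
    simpa [aleph0_le_mk] using hB.lift_cardinalMk_eq_max_lift
  have := linearIndependent_symbol (v := fun i : B ↦ Units.mk0 (i : K) (hB.1.ne_zero i)) hB o
  rw [hcard, ← mk_compl_of_infinite ({o} : Set B)
    (by simpa using one_lt_aleph0.trans_le (aleph0_le_mk B))]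
  exact this.cardinal_le_rank

end MilnorK

theorem Real.exists_infinite_algebraicIndependent :
    ∃ s : Set ℝ, s.Infinite ∧ AlgebraicIndependent ℚ ((↑) : s → ℝ) := by
  obtain ⟨s, hs⟩ := exists_isTranscendenceBasis ℚ ℝ
  refine ⟨s, fun hfin ↦ ?_, hs.1⟩
  have := hfin.countable.to_subtype
  refine not_countable (α := ℝ) (mk_le_aleph0_iff.1 ?_)
  have := hs.isAlgebraic
  refine (Algebra.IsAlgebraic.cardinalMk_le_max
    (Algebra.adjoin ℚ (Set.range ((↑) : s → ℝ))) ℝ).trans (max_le ?_ le_rfl)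
  rw [← mk_congr hs.1.aevalEquiv.toEquiv]
  exact MvPolynomial.cardinalMk_le_max.trans (by simp)

/-- Let `K` be a field of characteristic `0` of infinite transcendence
degree over `ℚ` (i.e. containing an infinite algebraically independent family). Then for
`n ≥ 2` the Milnor K-group `K^M_n(K)` has cardinality at most `card K`, and the rank of
`K^M_2(K) ⊗ ℚ` equals `card K`. In particular `K^M_2(ℝ) ⊗ ℚ` is an uncountable
`ℚ`-vector space. -/
theorem stmt_5 (K : Type) [Field K] [CharZero K]
    (htr : ∃ s : Set K, s.Infinite ∧ AlgebraicIndependent ℚ ((↑) : s → K)) :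
    (∀ n : ℕ, 2 ≤ n → Cardinal.mk (MilnorK n K) ≤ Cardinal.mk K) ∧
    Module.rank ℚ (ℚ ⊗[ℤ] MilnorK 2 K) = Cardinal.mk K ∧
    ¬ Countable (ℚ ⊗[ℤ] MilnorK 2 ℝ) := by
  have : Infinite K := CharZero.infinite K
  refine ⟨fun n _ ↦ MilnorK.cardinalMk_le n K, MilnorK.rank_eq K htr, fun h ↦ ?_⟩
  have hle := (rank_le_card ℚ (ℚ ⊗[ℤ] MilnorK 2 ℝ)).trans (mk_le_aleph0_iff.2 h)
  rw [MilnorK.rank_eq ℝ Real.exists_infinite_algebraicIndependent, mk_real] at hle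
  exact hle.not_gt aleph0_lt_continuum
end

section
/- Let $k$ be a field and $F/k$ a field extension. For each monic irreducible polynomial $p \in F[t]$, let $\kappa_p = F[t]/(p)$, and let $v_p$ be the corresponding discrete valuation on $F(t)$, with residue field $\kappa_p$. Then the residue maps induce an isomorphism of abelian groups $K^M_n(F(t)) \cong K^M_n(F) \oplus \bigoplus_p K^M_{n-1}(\kappa_p)$ for every $n$, where the first component is split by the inclusion $F \subseteq F(t)$ (Milnor's exact sequence for the rational function field). -/
namespace MilnorK

section Symbols

variable {n : ℕ} {K : Type} {A : Type*} [AddCommGroup A]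

section CommRing

variable [CommRing K]

theorem symbol_eq_add (u : Fin n → Kˣ) (i : Fin n) (s t : Kˣ) (h : u i = s * t) :
    (symbol u : MilnorK n K) =
      symbol (Function.update u i s) + symbol (Function.update u i t) := by
  have : FreeAbelianGroup.of u - FreeAbelianGroup.of (Function.update u i s) -
      FreeAbelianGroup.of (Function.update u i t) ∈ milnorRel n K :=
    AddSubgroup.subset_closure (Or.inl ⟨u, i, s, t, h, rfl⟩)
  have h2 := (QuotientAddGroup.eq_zero_iff _).2 this
  rw [← sub_eq_zero, ← sub_sub]
  exact h2

theorem symbol_eq_zero (u : Fin n → Kˣ) (i j : Fin n) (hij : i ≠ j)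
    (h : (u i : K) + (u j : K) = 1) : (symbol u : MilnorK n K) = 0 :=
  (QuotientAddGroup.eq_zero_iff _).2 (AddSubgroup.subset_closure (Or.inr ⟨u, i, j, hij, h, rfl⟩))

theorem symbol_update_mul (u : Fin n → Kˣ) (i : Fin n) (s t : Kˣ) :
    (symbol (Function.update u i (s * t)) : MilnorK n K) =
      symbol (Function.update u i s) + symbol (Function.update u i t) := by
  simpa using symbol_eq_add (Function.update u i (s * t)) i s t (by simp)

theorem symbol_update_one (u : Fin n → Kˣ) (i : Fin n) :
    (symbol (Function.update u i 1) : MilnorK n K) = 0 := by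
  simpa using symbol_update_mul u i 1 1

theorem symbol_update_inv (u : Fin n → Kˣ) (i : Fin n) (s : Kˣ) :
    (symbol (Function.update u i s⁻¹) : MilnorK n K) = - symbol (Function.update u i s) := by
  rw [eq_neg_iff_add_eq_zero, ← symbol_update_mul, inv_mul_cancel, symbol_update_one]

theorem symbol_eq_zero_of_eq_one (u : Fin n → Kˣ) (i : Fin n) (h : u i = 1) :
    (symbol u : MilnorK n K) = 0 := by
  rw [← Function.update_eq_self i u, h, symbol_update_one]

theorem closure_range_symbol :
    AddSubgroup.closure (Set.range (symbol : (Fin n → Kˣ) → MilnorK n K)) = ⊤ := by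
  rw [eq_top_iff]
  rintro x -
  induction x using QuotientAddGroup.induction_on with
  | H x =>
    induction x using FreeAbelianGroup.induction_on with
    | zero => exact zero_mem _
    | of u => exact AddSubgroup.subset_closure ⟨u, rfl⟩
    | neg u h => exact neg_mem h
    | add x y hx hy => exact add_mem hx hy

/-- A subgroup containing all symbols is everything. -/
theorem mem_of_forall_symbol_mem (N : AddSubgroup (MilnorK n K)) (h : ∀ u, symbol u ∈ N)
    (x : MilnorK n K) : x ∈ N := by
  have : AddSubgroup.closure (Set.range (symbol : (Fin n → Kˣ) → MilnorK n K)) ≤ N :=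
    (AddSubgroup.closure_le _).2 (by rintro _ ⟨u, rfl⟩; exact h u)
  exact this (closure_range_symbol (K := K) ▸ AddSubgroup.mem_top x)

theorem hom_ext {f g : MilnorK n K →+ A} (h : ∀ u, f (symbol u) = g (symbol u)) : f = g := by
  ext x
  exact mem_of_forall_symbol_mem (f.eqLocus g) h x

/-- The universal property of Milnor K-theory. -/
def lift (f : (Fin n → Kˣ) → A)
    (hmul : ∀ (u : Fin n → Kˣ) (i : Fin n) (s t : Kˣ), u i = s * t →
      f u = f (Function.update u i s) + f (Function.update u i t))
    (hst : ∀ (u : Fin n → Kˣ) (i j : Fin n), i ≠ j → (u i : K) + (u j : K) = 1 → f u = 0) :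
    MilnorK n K →+ A :=
  QuotientAddGroup.lift (milnorRel n K) (FreeAbelianGroup.lift f) (by
    refine (AddSubgroup.closure_le _).2 ?_
    rintro x (⟨u, i, s, t, h, rfl⟩ | ⟨u, i, j, hij, h, rfl⟩)
    · simp [hmul u i s t h]
    · simp [hst u i j hij h])

theorem lift_symbol (f : (Fin n → Kˣ) → A) (hmul) (hst) (u : Fin n → Kˣ) :
    lift f hmul hst (symbol u) = f u :=
  FreeAbelianGroup.lift_apply_of f u

/-- Multilinearity: membership of symbols in a subgroup may be checked on generators of the
entries. -/
theorem symbol_mem_of_mem_closure (N : AddSubgroup (MilnorK n K)) (S : Fin n → Set Kˣ)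
    (h : ∀ w, (∀ j, w j ∈ S j) → symbol w ∈ N) (w : Fin n → Kˣ)
    (hw : ∀ j, w j ∈ Subgroup.closure (S j)) : symbol w ∈ N := by
  suffices H : ∀ (s : Finset (Fin n)) (w : Fin n → Kˣ),
      (∀ j ∈ s, w j ∈ Subgroup.closure (S j)) → (∀ j ∉ s, w j ∈ S j) → symbol w ∈ N from
    H Finset.univ w (fun j _ => hw j) (by simp)
  intro s
  induction s using Finset.induction_on with
  | empty => exact fun w _ hw => h w (fun j => hw j (by simp))
  | insert a s ha ih =>
    intro w hw1 hw2
    suffices H : ∀ x ∈ Subgroup.closure (S a), symbol (Function.update w a x) ∈ N by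
      simpa using H (w a) (hw1 a (by simp))
    intro x hx
    induction hx using Subgroup.closure_induction with
    | mem x hx =>
      apply ih
      · intro j hj
        have : j ≠ a := fun e => ha (e ▸ hj)
        rw [Function.update_of_ne this]
        exact hw1 j (by simp [hj])
      · intro j hj
        by_cases e : j = a
        · subst e; simpa using hx
        · rw [Function.update_of_ne e]
          exact hw2 j (by simp [hj, e])
    | one => rw [symbol_update_one]; exact zero_mem _
    | mul x y _ _ hx hy => rw [symbol_update_mul]; exact add_mem hx hy
    | inv x _ hx => rw [symbol_update_inv]; exact neg_mem hx

/-- A map `Kˣ × Kˣ → A` that is multiplicative in each variable and kills Steinberg pairs. -/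
structure IsSteinberg (B : Kˣ → Kˣ → A) : Prop where
  mul_left : ∀ a b c, B (a * b) c = B a c + B b c
  mul_right : ∀ a b c, B a (b * c) = B a b + B a c
  eq_zero : ∀ a b : Kˣ, (a : K) + b = 1 → B a b = 0

namespace IsSteinberg

variable {B : Kˣ → Kˣ → A} (hB : IsSteinberg B)
include hB

theorem one_left (a : Kˣ) : B 1 a = 0 := by simpa using hB.mul_left 1 1 a

theorem one_right (a : Kˣ) : B a 1 = 0 := by simpa using hB.mul_right a 1 1

theorem inv_left (a b : Kˣ) : B a⁻¹ b = - B a b := by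
  rw [eq_neg_iff_add_eq_zero, ← hB.mul_left, inv_mul_cancel, hB.one_left]

theorem inv_right (a b : Kˣ) : B a b⁻¹ = - B a b := by
  rw [eq_neg_iff_add_eq_zero, ← hB.mul_right, inv_mul_cancel, hB.one_right]

theorem div_left (a b c : Kˣ) : B (a / b) c = B a c - B b c := by
  rw [div_eq_mul_inv, hB.mul_left, hB.inv_left, sub_eq_add_neg]

theorem div_right (a b c : Kˣ) : B a (b / c) = B a b - B a c := by
  rw [div_eq_mul_inv, hB.mul_right, hB.inv_right, sub_eq_add_neg]

end IsSteinberg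

theorem isSteinberg_symbol (w : Fin n → Kˣ) {i j : Fin n} (hij : i ≠ j) :
    IsSteinberg fun a b => (symbol (Function.update (Function.update w i a) j b) :
      MilnorK n K) where
  mul_left a b c := by
    simp only [Function.update_comm hij]
    exact symbol_update_mul _ _ _ _
  mul_right a b c := symbol_update_mul _ _ _ _
  eq_zero a b h := symbol_eq_zero _ i j hij (by simp [Function.update_of_ne hij, h])

end CommRing

section Field

variable [Field K]

namespace IsSteinberg

variable {B : Kˣ → Kˣ → A} (hB : IsSteinberg B)
include hB

theorem neg_right (a : Kˣ) : B a (-a) = 0 := by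
  by_cases h : a = 1
  · rw [h, hB.one_left]
  have h1 : (1 : K) - a ≠ 0 := fun e => h (Units.ext (by simpa using (sub_eq_zero.1 e).symm))
  have ha : (a : K) ≠ 0 := a.ne_zero
  have h2 : (1 : K) - (a : K)⁻¹ ≠ 0 := fun e => h (Units.ext (by
    simpa using (sub_eq_zero.1 e).symm))
  have e : -a = Units.mk0 _ h1 / Units.mk0 _ h2 := by
    ext
    rw [Units.val_div_eq_div_val, eq_div_iff (by simpa using h2)]
    simp only [Units.val_neg, Units.val_mk0]
    field_simp
    ring
  have s1 := hB.eq_zero a (Units.mk0 _ h1) (by simp)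
  have s2 := hB.eq_zero a⁻¹ (Units.mk0 _ h2) (by simp)
  rw [hB.inv_left] at s2
  rw [e, hB.div_right, s1, zero_sub, s2]

theorem swap (a b : Kˣ) : B a b = - B b a := by
  have h := hB.neg_right (a * b)
  have e1 : B a (-(a * b)) = B a (-a) + B a b := by rw [← hB.mul_right]; congr 1; simp
  have e2 : B b (-(a * b)) = B b (-b) + B b a := by
    rw [← hB.mul_right]; congr 1; rw [neg_mul, mul_comm]
  rw [hB.mul_left, e1, e2, hB.neg_right, hB.neg_right, zero_add, zero_add] at h
  exact eq_neg_of_add_eq_zero_left h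

theorem self (a : Kˣ) : B a a = B a (-1) := by
  have : B a a = B a (-a) + B a (-1) := by rw [← hB.mul_right]; congr 1; simp
  rw [this, hB.neg_right, zero_add]

/-- If `a = b + c` then `{a, b}` can be rewritten with `b` replaced by `c` or `-1`. -/
theorem eq_of_add_eq (a b c : Kˣ) (h : (a : K) + c = b) :
    B a b = B a c - B b c + B b (-1) := by
  have h0 := hB.eq_zero (a / b) (c / b) (by
    rw [Units.val_div_eq_div_val, Units.val_div_eq_div_val, ← add_div, h, div_self b.ne_zero])
  rw [hB.div_left, hB.div_right, hB.div_right, hB.self b] at h0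
  rw [← sub_eq_zero, ← neg_eq_zero, ← h0]
  abel

end IsSteinberg

theorem symbol_comp_swap (w : Fin n → Kˣ) {i j : Fin n} (hij : i ≠ j) :
    (symbol (w ∘ Equiv.swap i j) : MilnorK n K) = - symbol w := by
  have h := (isSteinberg_symbol w hij).swap (w j) (w i)
  simp only [Function.update_eq_self] at h
  rw [← h]
  congr 1
  ext k
  rcases eq_or_ne k j with rfl | hj
  · simp
  rcases eq_or_ne k i with rfl | hi
  · simp [Function.update_of_ne hij]
  · simp [Function.update_of_ne, hj, hi, Equiv.swap_apply_of_ne_of_ne]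

end Field

end Symbols
open Polynomial

section RationalFunctionField

variable {F : Type} [Field F] {n : ℕ}

/-- The leading coefficient, as a homomorphism `F(t) →*₀ F`. -/
noncomputable def ratLeadingCoeff (F : Type) [Field F] : RatFunc F →*₀ F :=
  RatFunc.liftMonoidWithZeroHom
    { toFun := Polynomial.leadingCoeff
      map_zero' := leadingCoeff_zero
      map_one' := leadingCoeff_one
      map_mul' := leadingCoeff_mul }
    (fun f hf => by
      have : f ≠ 0 := nonZeroDivisors.ne_zero hf
      simpa using this)

theorem ratLeadingCoeff_div (f g : F[X]) :
    ratLeadingCoeff F (algebraMap F[X] (RatFunc F) f / algebraMap F[X] (RatFunc F) g) =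
      f.leadingCoeff / g.leadingCoeff :=
  RatFunc.liftMonoidWithZeroHom_apply_div _ _ _ _

theorem ratLeadingCoeff_C (c : F) : ratLeadingCoeff F (algebraMap F (RatFunc F) c) = c := by
  have := ratLeadingCoeff_div (C c) 1
  simpa [IsScalarTower.algebraMap_apply F F[X] (RatFunc F)] using this

theorem ratLeadingCoeff_of_add_eq_one (a b : RatFunc F) (h : a + b = 1) :
    ratLeadingCoeff F a = 1 ∨ ratLeadingCoeff F b = 1 ∨
      ratLeadingCoeff F b = - ratLeadingCoeff F a ∨
      ratLeadingCoeff F a + ratLeadingCoeff F b = 1 := by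
  obtain ⟨f, g, hg, rfl⟩ : ∃ f g : F[X], g ≠ 0 ∧
      algebraMap F[X] (RatFunc F) f / algebraMap F[X] (RatFunc F) g = a :=
    ⟨a.num, a.denom, a.denom_ne_zero, a.num_div_denom⟩
  have hg' : algebraMap F[X] (RatFunc F) g ≠ 0 := RatFunc.algebraMap_ne_zero hg
  have hl : g.leadingCoeff ≠ 0 := leadingCoeff_ne_zero.2 hg
  obtain rfl : b = algebraMap F[X] (RatFunc F) (g - f) / algebraMap F[X] (RatFunc F) g := by
    rw [map_sub, sub_div, div_self hg', ← h, add_sub_cancel_left]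
  simp only [ratLeadingCoeff_div]
  rcases lt_trichotomy f.degree g.degree with hd | hd | hd
  · right; left
    rw [leadingCoeff_sub_of_degree_lt hd, div_self hl]
  · by_cases hc : f.leadingCoeff = g.leadingCoeff
    · left
      rw [hc, div_self hl]
    · right; right; right
      rw [leadingCoeff_sub_of_degree_eq hd.symm (Ne.symm hc), ← add_div, add_sub_cancel, div_self hl]
  · right; right; left
    rw [leadingCoeff_sub_of_degree_lt' hd, neg_div]

/-- The specialization of Milnor K-theory at infinity with respect to the uniformizer `1 / t`,
which replaces rational functions by their leading coefficients. -/
noncomputable def specialization (F : Type) [Field F] (n : ℕ) :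
    MilnorK n (RatFunc F) →+ MilnorK n F :=
  lift (fun u => symbol fun j => Units.map (ratLeadingCoeff F : RatFunc F →* F) (u j))
    (fun u i s t h => by
      have := symbol_eq_add (fun j => Units.map (ratLeadingCoeff F : RatFunc F →* F) (u j)) i
        (Units.map (ratLeadingCoeff F : RatFunc F →* F) s)
        (Units.map (ratLeadingCoeff F : RatFunc F →* F) t) (by simp [h])
      convert this using 3 <;>
      · funext j
        exact Function.apply_update
          (fun _ => Units.map (ratLeadingCoeff F : RatFunc F →* F)) u i _ j)
    (fun u i j hij h => by
      rcases ratLeadingCoeff_of_add_eq_one _ _ h with h | h | h | h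
      · exact symbol_eq_zero_of_eq_one _ i (Units.ext h)
      · exact symbol_eq_zero_of_eq_one _ j (Units.ext h)
      · set w : Fin n → Fˣ := fun j => Units.map (ratLeadingCoeff F : RatFunc F →* F) (u j)
        have := (isSteinberg_symbol w hij).neg_right (w i)
        have e : w j = - w i := Units.ext h
        simpa [← e] using this
      · exact symbol_eq_zero _ i j hij h)

theorem specialization_symbol (u : Fin n → (RatFunc F)ˣ) :
    specialization F n (symbol u) =
      symbol fun j => Units.map (ratLeadingCoeff F : RatFunc F →* F) (u j) :=
  lift_symbol _ _ _ _

open Classical in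
/-- A nonzero polynomial as a unit of the rational function field; the value at `0` is `1`. -/
noncomputable def polyUnit (f : F[X]) : (RatFunc F)ˣ :=
  if h : f = 0 then 1 else Units.mk0 (algebraMap F[X] (RatFunc F) f) (RatFunc.algebraMap_ne_zero h)

theorem val_polyUnit {f : F[X]} (hf : f ≠ 0) :
    (polyUnit f : RatFunc F) = algebraMap F[X] (RatFunc F) f := by
  simp [polyUnit, hf]

theorem polyUnit_mul {f g : F[X]} (hf : f ≠ 0) (hg : g ≠ 0) :
    polyUnit (f * g) = polyUnit f * polyUnit g := by
  ext
  rw [Units.val_mul, val_polyUnit (mul_ne_zero hf hg), val_polyUnit hf, val_polyUnit hg, map_mul]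

theorem polyUnit_neg_one : polyUnit (-1 : F[X]) = -1 := by
  ext
  simp [val_polyUnit]

/-- The units of `F(t)` given by nonzero polynomials of degree less than `d`. -/
def lowDegree (F : Type) [Field F] (d : ℕ) : Set (RatFunc F)ˣ :=
  {x | ∃ f : F[X], f ≠ 0 ∧ f.degree < d ∧ polyUnit f = x}

/-- The units of `F(t)` given by monic irreducible polynomials of degree `d`. -/
def primesOfDegree (F : Type) [Field F] (d : ℕ) : Set (RatFunc F)ˣ :=
  {x | ∃ p : F[X], (p.Monic ∧ Irreducible p) ∧ p.natDegree = d ∧ polyUnit p = x}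

theorem lowDegree_mono {d e : ℕ} (h : d ≤ e) : lowDegree F d ⊆ lowDegree F e := by
  rintro _ ⟨f, hf, hd, rfl⟩
  exact ⟨f, hf, hd.trans_le (by exact_mod_cast h), rfl⟩

theorem exists_mem_closure_lowDegree (x : (RatFunc F)ˣ) :
    ∃ d, x ∈ Subgroup.closure (lowDegree F d) := by
  have hn : (x : RatFunc F).num ≠ 0 := RatFunc.num_ne_zero x.ne_zero
  have hd : (x : RatFunc F).denom ≠ 0 := RatFunc.denom_ne_zero _
  have e : x = polyUnit (x : RatFunc F).num / polyUnit (x : RatFunc F).denom := by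
    ext
    rw [Units.val_div_eq_div_val, val_polyUnit hn, val_polyUnit hd, RatFunc.num_div_denom]
  have key : ∀ f : F[X], f ≠ 0 → ∀ d, f.natDegree < d →
      polyUnit f ∈ Subgroup.closure (lowDegree F d) := fun f hf d h =>
    Subgroup.subset_closure ⟨f, hf, (natDegree_lt_iff_degree_lt hf).1 h, rfl⟩
  refine ⟨max (x : RatFunc F).num.natDegree (x : RatFunc F).denom.natDegree + 1, ?_⟩
  have := div_mem (key _ hn _ (Nat.lt_succ_of_le (le_max_left _ _)))
    (key _ hd _ (Nat.lt_succ_of_le (le_max_right _ _)))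
  rwa [← e] at this

/-- A polynomial of degree at most `d` is a product of polynomials of smaller degree and monic
irreducible polynomials of degree `d`. -/
theorem closure_lowDegree_succ_le {d : ℕ} (hd : 1 ≤ d) :
    Subgroup.closure (lowDegree F (d + 1)) ≤
      Subgroup.closure (lowDegree F d ∪ primesOfDegree F d) := by
  refine (Subgroup.closure_le _).2 ?_
  rintro _ ⟨f, hf, hfd, rfl⟩
  have low : ∀ g : F[X], g ≠ 0 → g.natDegree < d →
      polyUnit g ∈ Subgroup.closure (lowDegree F d ∪ primesOfDegree F d) := fun g hg h =>
    Subgroup.subset_closure (Or.inl ⟨g, hg, (natDegree_lt_iff_degree_lt hg).1 h, rfl⟩)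
  have hfd' : f.natDegree < d + 1 := (natDegree_lt_iff_degree_lt hf).2 hfd
  rcases Nat.lt_succ_iff_lt_or_eq.1 hfd' with h | h
  · exact low f hf h
  have hu : ¬ IsUnit f := fun hu => by
    have := natDegree_eq_zero_of_isUnit hu
    omega
  by_cases hirr : Irreducible f
  · have hc : (C f.leadingCoeff : F[X]) ≠ 0 := by simpa using hf
    have hc' : (C f.leadingCoeff⁻¹ : F[X]) ≠ 0 := by simpa using hf
    have e : f = C f.leadingCoeff * (f * C f.leadingCoeff⁻¹) := by
      rw [mul_left_comm, ← C_mul, mul_inv_cancel₀ (leadingCoeff_ne_zero.2 hf), C_1, mul_one]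
    have hu : IsUnit (C f.leadingCoeff⁻¹ : F[X]) :=
      isUnit_C.2 (IsUnit.mk0 _ (inv_ne_zero (leadingCoeff_ne_zero.2 hf)))
    have hirr' : Irreducible (f * C f.leadingCoeff⁻¹) := (irreducible_mul_isUnit hu).2 hirr
    rw [SetLike.mem_coe, e, polyUnit_mul hc (mul_ne_zero hf hc')]
    refine mul_mem (low _ hc (by rw [natDegree_C]; omega)) (Subgroup.subset_closure (Or.inr
      ⟨_, ⟨monic_mul_leadingCoeff_inv hf, hirr'⟩, ?_, rfl⟩))
    rw [natDegree_mul hf hc', natDegree_C, h, add_zero]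
  · obtain ⟨a, b, ha, hb, e⟩ : ∃ a b : F[X], ¬ IsUnit a ∧ ¬ IsUnit b ∧ f = a * b := by
      by_contra! H
      exact hirr ⟨hu, fun a b e => or_iff_not_imp_left.2 fun ha => by
        by_contra hb
        exact H a b ha hb e⟩
    have ha0 : a ≠ 0 := by rintro rfl; exact hf (by simpa using e)
    have hb0 : b ≠ 0 := by rintro rfl; exact hf (by simpa using e)
    have hda : a.natDegree ≠ 0 := fun h => ha (by
      rw [isUnit_iff_degree_eq_zero, degree_eq_natDegree ha0, h]; rfl)
    have hdb : b.natDegree ≠ 0 := fun h => hb (by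
      rw [isUnit_iff_degree_eq_zero, degree_eq_natDegree hb0, h]; rfl)
    have hdeg : f.natDegree = a.natDegree + b.natDegree := by rw [e, natDegree_mul ha0 hb0]
    rw [SetLike.mem_coe, e, polyUnit_mul ha0 hb0]
    exact mul_mem (low a ha0 (by omega)) (low b hb0 (by omega))

/-- The subgroup of `K^M_m(F(t))` generated by symbols in polynomials of degree less than `d`. -/
noncomputable def filtration (F : Type) [Field F] (m d : ℕ) : AddSubgroup (MilnorK m (RatFunc F)) :=
  AddSubgroup.closure {x | ∃ w : Fin m → (RatFunc F)ˣ,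
    (∀ j, w j ∈ Subgroup.closure (lowDegree F d)) ∧ x = symbol w}

theorem symbol_mem_filtration {d : ℕ} (w : Fin n → (RatFunc F)ˣ)
    (hw : ∀ j, w j ∈ Subgroup.closure (lowDegree F d)) : symbol w ∈ filtration F n d :=
  AddSubgroup.subset_closure ⟨w, hw, rfl⟩

theorem filtration_mono {d e : ℕ} (h : d ≤ e) : filtration F n d ≤ filtration F n e := by
  refine (AddSubgroup.closure_le _).2 ?_
  rintro _ ⟨w, hw, rfl⟩
  exact symbol_mem_filtration w fun j => Subgroup.closure_mono (lowDegree_mono h) (hw j)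

theorem filtration_le {d : ℕ} (N : AddSubgroup (MilnorK n (RatFunc F)))
    (h : ∀ g : Fin n → F[X], (∀ j, g j ≠ 0) → (∀ j, (g j).degree < d) →
      symbol (fun j => polyUnit (g j)) ∈ N) : filtration F n d ≤ N := by
  refine (AddSubgroup.closure_le _).2 ?_
  rintro _ ⟨w, hw, rfl⟩
  refine symbol_mem_of_mem_closure N (fun _ => lowDegree F d) (fun w hw => ?_) w hw
  choose g h0 hd hg using hw
  obtain rfl : (fun j => polyUnit (g j)) = w := funext hg
  exact h g h0 hd

theorem exists_mem_filtration (x : MilnorK n (RatFunc F)) : ∃ d, x ∈ filtration F n d := by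
  have hx := closure_range_symbol (K := RatFunc F) ▸ AddSubgroup.mem_top x
  induction hx using AddSubgroup.closure_induction with
  | mem x hx =>
    obtain ⟨w, rfl⟩ := hx
    choose d hd using fun j => exists_mem_closure_lowDegree (w j)
    exact ⟨Finset.univ.sup d, symbol_mem_filtration w fun j =>
      Subgroup.closure_mono (lowDegree_mono (Finset.le_sup (Finset.mem_univ j))) (hd j)⟩
  | zero => exact ⟨0, zero_mem _⟩
  | add x y _ _ hx hy =>
    obtain ⟨d, hd⟩ := hx
    obtain ⟨e, he⟩ := hy
    exact ⟨max d e, add_mem (filtration_mono (le_max_left _ _) hd)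
      (filtration_mono (le_max_right _ _) he)⟩
  | neg x _ hx => exact hx.imp fun d hd => neg_mem hd

theorem neg_one_mem_lowDegree {d : ℕ} (hd : 1 ≤ d) : (-1 : (RatFunc F)ˣ) ∈ lowDegree F d :=
  ⟨-1, by simp, by
    rw [degree_neg, degree_one]
    exact_mod_cast hd, polyUnit_neg_one⟩

/-- The step from `d` to `d + 1` of the filtration is generated by the symbols
`{p, g₁, …, gₙ}` with `p` monic irreducible of degree `d` and the `gᵢ` of smaller degree. -/
theorem filtration_succ_le {d : ℕ} (hd : 1 ≤ d) (N : AddSubgroup (MilnorK (n + 1) (RatFunc F)))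
    (h0 : filtration F (n + 1) d ≤ N)
    (h : ∀ p : F[X], p.Monic ∧ Irreducible p → p.natDegree = d →
      ∀ g : Fin n → F[X], (∀ j, g j ≠ 0) → (∀ j, (g j).degree < d) →
      symbol (Fin.cons (polyUnit p) fun j => polyUnit (g j) : Fin (n + 1) → (RatFunc F)ˣ) ∈ N) :
    filtration F (n + 1) (d + 1) ≤ N := by
  classical
  set G := Subgroup.closure (lowDegree F d) with hG
  have head : ∀ w : Fin (n + 1) → (RatFunc F)ˣ, w 0 ∈ primesOfDegree F d →
      (∀ j, j ≠ 0 → w j ∈ G) → symbol w ∈ N := by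
    intro w hw0 hw
    refine symbol_mem_of_mem_closure N
      (Fin.cons (primesOfDegree F d) fun _ => lowDegree F d) (fun w hw => ?_) w (fun j => ?_)
    · obtain ⟨p, hp, hpd, hp0⟩ := hw 0
      have hw' : ∀ j : Fin n, w j.succ ∈ lowDegree F d := fun j => by simpa using hw j.succ
      choose g hg0 hgd hg using hw'
      have e : w = Fin.cons (polyUnit p) fun j => polyUnit (g j) := by
        ext j
        refine Fin.cases ?_ (fun j => ?_) j
        · simp [hp0]
        · simp [hg]
      rw [e]
      exact h p hp hpd g hg0 hgd
    · refine Fin.cases ?_ (fun j => ?_) j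
      · exact Subgroup.subset_closure (by simpa using hw0)
      · simpa using hw j.succ (Fin.succ_ne_zero j)
  have single : ∀ (w : Fin (n + 1) → (RatFunc F)ˣ) (i : Fin (n + 1)), w i ∈ primesOfDegree F d →
      (∀ j, j ≠ i → w j ∈ G) → symbol w ∈ N := by
    intro w i hi hw
    rcases eq_or_ne 0 i with rfl | h0i
    · exact head w hi hw
    rw [← neg_mem_iff, ← symbol_comp_swap w h0i]
    refine head _ (by simpa using hi) fun j hj => hw _ fun e => hj ?_
    rwa [Equiv.swap_apply_eq_iff, Equiv.swap_apply_right] at e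
  have count : ∀ (k : ℕ) (w : Fin (n + 1) → (RatFunc F)ˣ),
      (∀ j, w j ∈ G ∨ w j ∈ primesOfDegree F d) →
      (Finset.univ.filter fun j => w j ∉ G).card = k → symbol w ∈ N := by
    intro k
    induction k using Nat.strong_induction_on with
    | _ k ih =>
    intro w hw hk
    by_cases hex : ∃ i j, i ≠ j ∧ w i ∉ G ∧ w j ∉ G
    · obtain ⟨i, j, hij, hi, hj⟩ := hex
      have hB := isSteinberg_symbol w hij
      have key : ∀ x ∈ primesOfDegree F d, ∀ y ∈ lowDegree F d,
          symbol (Function.update (Function.update w i x) j y) ∈ N := by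
        intro x hx y hy
        have hyG : y ∈ G := Subgroup.subset_closure hy
        refine ih _ ?_ _ (fun l => ?_) rfl
        · rw [← hk]
          refine Finset.card_lt_card ((Finset.ssubset_iff_of_subset fun l hl => ?_).2 ⟨j, ?_, ?_⟩)
          · rw [Finset.mem_filter] at hl ⊢
            refine ⟨hl.1, ?_⟩
            rcases eq_or_ne l i with rfl | hli
            · exact hi
            rcases eq_or_ne l j with rfl | hlj
            · exact hj
            simpa [Function.update_of_ne, hli, hlj] using hl.2
          · simpa using hj
          · simpa using hyG
        · rcases eq_or_ne l j with rfl | hlj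
          · left; simpa using hyG
          rcases eq_or_ne l i with rfl | hli
          · right; simpa [Function.update_of_ne hlj] using hx
          simpa [Function.update_of_ne, hli, hlj] using hw l
      have hi' := (hw i).resolve_left hi
      have hj' := (hw j).resolve_left hj
      have e : symbol w = symbol (Function.update (Function.update w i (w i)) j (w j)) := by simp
      rw [e]
      by_cases hwij : w i = w j
      · rw [← hwij]
        have := hB.self (w i)
        beta_reduce at this
        rw [this]
        exact key _ hi' _ (neg_one_mem_lowDegree hd)
      · obtain ⟨p, hp, hpd, hpi⟩ := hi'
        obtain ⟨q, hq, hqd, hqj⟩ := hj'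
        have hqp : q - p ≠ 0 := fun h => hwij (by rw [← hpi, ← hqj, sub_eq_zero.1 h])
        have hdeg : (q - p).degree < d := by
          rw [← hqd, ← degree_eq_natDegree hq.1.ne_zero]
          refine degree_sub_lt_left ?_ hq.1.ne_zero (by rw [hp.1.leadingCoeff, hq.1.leadingCoeff])
          rw [degree_eq_natDegree hq.1.ne_zero, degree_eq_natDegree hp.1.ne_zero, hpd, hqd]
        have hl : polyUnit (q - p) ∈ lowDegree F d := ⟨_, hqp, hdeg, rfl⟩
        have := hB.eq_of_add_eq (w i) (w j) (polyUnit (q - p)) (by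
          rw [← hpi, ← hqj, val_polyUnit hp.1.ne_zero, val_polyUnit hq.1.ne_zero,
            val_polyUnit hqp, map_sub, add_sub_cancel])
        beta_reduce at this
        rw [this]
        exact add_mem (sub_mem (key _ ⟨p, hp, hpd, hpi⟩ _ hl) (key _ ⟨q, hq, hqd, hqj⟩ _ hl))
          (key _ ⟨q, hq, hqd, hqj⟩ _ (neg_one_mem_lowDegree hd))
    · push Not at hex
      by_cases hone : ∃ i, w i ∉ G
      · obtain ⟨i, hi⟩ := hone
        exact single w i ((hw i).resolve_left hi) fun j hj => hex i j hj.symm hi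
      · push Not at hone
        exact h0 (symbol_mem_filtration w hone)
  refine (AddSubgroup.closure_le _).2 ?_
  rintro _ ⟨w, hw, rfl⟩
  exact symbol_mem_of_mem_closure N (fun _ => lowDegree F d ∪ primesOfDegree F d)
    (fun w hw => count _ w (fun j => (hw j).imp_left fun h => Subgroup.subset_closure h) rfl) w
    fun j => closure_lowDegree_succ_le hd (hw j)

/-- Modulo symbols of smaller degree, `{p, g₁, …, gₙ}` is multiplicative in the classes of the
`gᵢ` modulo `p`. -/
theorem symbol_cons_sub_sub_mem_filtration {p : F[X]} (hp : p.Monic) (v : Fin n → (RatFunc F)ˣ)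
    (hv : ∀ j, v j ∈ Subgroup.closure (lowDegree F p.natDegree)) (i : Fin n) (f g h : F[X])
    (hf : f ≠ 0) (hg : g ≠ 0) (hh : h ≠ 0) (hfd : f.degree < p.natDegree)
    (hgd : g.degree < p.natDegree) (hhd : h.degree < p.natDegree) (hdvd : p ∣ g * h - f) :
    (symbol (Fin.cons (polyUnit p) (Function.update v i (polyUnit f)) :
        Fin (n + 1) → (RatFunc F)ˣ) : MilnorK (n + 1) (RatFunc F)) -
      symbol (Fin.cons (polyUnit p) (Function.update v i (polyUnit g)) :
        Fin (n + 1) → (RatFunc F)ˣ) -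
      symbol (Fin.cons (polyUnit p) (Function.update v i (polyUnit h)) :
        Fin (n + 1) → (RatFunc F)ˣ) ∈ filtration F (n + 1) p.natDegree := by
  have hB := isSteinberg_symbol (Fin.cons (polyUnit p) v : Fin (n + 1) → (RatFunc F)ˣ)
    (Fin.succ_ne_zero i).symm
  set B := fun a b => (symbol (Function.update (Function.update
    (Fin.cons (polyUnit p) v : Fin (n + 1) → (RatFunc F)ˣ) 0 a) i.succ b) :
      MilnorK (n + 1) (RatFunc F)) with hBdef
  have hBp : ∀ x, (symbol (Fin.cons (polyUnit p) (Function.update v i x) :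
      Fin (n + 1) → (RatFunc F)ˣ) : MilnorK (n + 1) (RatFunc F)) = B (polyUnit p) x := by
    intro x
    simp [hBdef, Fin.cons_update]
  have hBmem : ∀ x ∈ Subgroup.closure (lowDegree F p.natDegree),
      ∀ y ∈ Subgroup.closure (lowDegree F p.natDegree),
      B x y ∈ filtration F (n + 1) p.natDegree := by
    intro x hx y hy
    refine symbol_mem_filtration _ fun j => ?_
    refine Fin.cases ?_ (fun j => ?_) j
    · simpa [Function.update_of_ne (Fin.succ_ne_zero i).symm] using hx
    · rcases eq_or_ne j i with rfl | hji
      · simpa using hy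
      · simpa [Function.update_of_ne, hji] using hv j
  rw [hBp, hBp, hBp, ← hB.div_right, ← hB.div_right]
  have low : ∀ k : F[X], k ≠ 0 → k.degree < p.natDegree →
      polyUnit k ∈ Subgroup.closure (lowDegree F p.natDegree) := fun k hk hkd =>
    Subgroup.subset_closure ⟨k, hk, hkd, rfl⟩
  obtain ⟨q, hq⟩ := hdvd
  by_cases hq0 : q = 0
  · have e : f = g * h := by
      rw [hq0, mul_zero, sub_eq_zero] at hq
      exact hq.symm
    have : polyUnit f / polyUnit g / polyUnit h = 1 := by
      rw [e, polyUnit_mul hg hh, div_div, div_self']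
    rw [this, hB.one_right]
    exact zero_mem _
  · have hp0 := hp.ne_zero
    have hqd : q.degree < p.natDegree := by
      have h1 : (p * q).natDegree < p.natDegree + p.natDegree := by
        rw [← hq]
        have hgn := (natDegree_lt_iff_degree_lt hg).2 hgd
        have hhn := (natDegree_lt_iff_degree_lt hh).2 hhd
        have hfn := (natDegree_lt_iff_degree_lt hf).2 hfd
        refine (natDegree_sub_le _ _).trans_lt (max_lt ?_ (by omega))
        rw [natDegree_mul hg hh]
        omega
      rw [natDegree_mul hp0 hq0] at h1
      exact (natDegree_lt_iff_degree_lt hq0).1 (by omega)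
    have hpu := (polyUnit p).ne_zero
    have hgu := (polyUnit g).ne_zero
    have hhu := (polyUnit h).ne_zero
    have hs := hB.eq_zero (polyUnit p * (polyUnit q / polyUnit g / polyUnit h))
      (polyUnit f / polyUnit g / polyUnit h) (by
        have hq' := congrArg (algebraMap F[X] (RatFunc F)) hq
        rw [map_sub, map_mul, map_mul, ← val_polyUnit hg, ← val_polyUnit hh, ← val_polyUnit hf,
          ← val_polyUnit hp0, ← val_polyUnit hq0] at hq'
        simp only [Units.val_mul, Units.val_div_eq_div_val]
        field_simp
        rw [← hq', sub_add_cancel])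
    rw [hB.mul_left] at hs
    rw [eq_neg_of_add_eq_zero_left hs]
    exact neg_mem (hBmem _ (div_mem (div_mem (low q hq0 hqd) (low g hg hgd)) (low h hh hhd)) _
      (div_mem (div_mem (low f hf hfd) (low g hg hgd)) (low h hh hhd)))

section Residue

variable {p : F[X]} (hp : p.Monic ∧ Irreducible p)
include hp

theorem mk_modByMonicHom (a : AdjoinRoot p) :
    AdjoinRoot.mk p (AdjoinRoot.modByMonicHom hp.1 a) = a :=
  AdjoinRoot.mk_leftInverse hp.1 a

theorem degree_modByMonicHom_lt (a : AdjoinRoot p) :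
    (AdjoinRoot.modByMonicHom hp.1 a).degree < p.natDegree := by
  obtain ⟨f, rfl⟩ := AdjoinRoot.mk_surjective a
  rw [AdjoinRoot.modByMonicHom_mk, ← degree_eq_natDegree hp.1.ne_zero]
  exact degree_modByMonic_lt f hp.1

theorem modByMonicHom_mk_of_degree_lt {f : F[X]} (hf : f.degree < p.natDegree) :
    AdjoinRoot.modByMonicHom hp.1 (AdjoinRoot.mk p f) = f := by
  rw [AdjoinRoot.modByMonicHom_mk, modByMonic_eq_self_iff hp.1, degree_eq_natDegree hp.1.ne_zero]
  exact hf

theorem modByMonicHom_unit_ne_zero (a : (AdjoinRoot p)ˣ) :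
    AdjoinRoot.modByMonicHom hp.1 (a : AdjoinRoot p) ≠ 0 := by
  have : Fact (Irreducible p) := ⟨hp.2⟩
  intro h
  have h2 := mk_modByMonicHom hp a
  rw [h, map_zero] at h2
  exact a.ne_zero h2.symm

theorem polyUnit_modByMonicHom_mem (a : (AdjoinRoot p)ˣ) :
    polyUnit (AdjoinRoot.modByMonicHom hp.1 (a : AdjoinRoot p)) ∈
      Subgroup.closure (lowDegree F p.natDegree) :=
  Subgroup.subset_closure ⟨_, modByMonicHom_unit_ne_zero hp a, degree_modByMonicHom_lt hp _, rfl⟩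

theorem not_dvd_of_degree_lt {f : F[X]} (hf : f ≠ 0) (h : f.degree < p.natDegree) : ¬ p ∣ f :=
  fun hd => by
    have := degree_le_of_dvd hd hf
    rw [degree_eq_natDegree hp.1.ne_zero] at this
    exact absurd h (not_lt.2 this)

/-- The entries of the symbol `{p, g₁, …, gₙ}` with `gᵢ` the representative of `uᵢ` of degree less
than `deg p`. -/
noncomputable def liftEntries (u : Fin n → (AdjoinRoot p)ˣ) : Fin (n + 1) → (RatFunc F)ˣ :=
  Fin.cons (polyUnit p) fun j => polyUnit (AdjoinRoot.modByMonicHom hp.1 (u j : AdjoinRoot p))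

/-- Milnor's map `{ḡ₁, …, ḡₙ} ↦ {p, g₁, …, gₙ}` for polynomials `gᵢ` of degree less than `deg p`,
modulo symbols in polynomials of degree less than `deg p`. -/
noncomputable def residueSection : MilnorK n (AdjoinRoot p) →+
    MilnorK (n + 1) (RatFunc F) ⧸ filtration F (n + 1) p.natDegree :=
  lift (fun u => QuotientAddGroup.mk (symbol (liftEntries hp u)))
    (fun u i s t hu => by
      rw [← QuotientAddGroup.mk_add, ← sub_eq_zero, ← QuotientAddGroup.mk_sub,
        QuotientAddGroup.eq_zero_iff, ← sub_sub]
      have h := symbol_cons_sub_sub_mem_filtration hp.1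
        (fun j => polyUnit (AdjoinRoot.modByMonicHom hp.1 (u j : AdjoinRoot p)))
        (fun j => polyUnit_modByMonicHom_mem hp (u j)) i
        (AdjoinRoot.modByMonicHom hp.1 (u i : AdjoinRoot p))
        (AdjoinRoot.modByMonicHom hp.1 (s : AdjoinRoot p))
        (AdjoinRoot.modByMonicHom hp.1 (t : AdjoinRoot p))
        (modByMonicHom_unit_ne_zero hp _) (modByMonicHom_unit_ne_zero hp _)
        (modByMonicHom_unit_ne_zero hp _) (degree_modByMonicHom_lt hp _)
        (degree_modByMonicHom_lt hp _) (degree_modByMonicHom_lt hp _) (by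
          rw [← AdjoinRoot.mk_eq_mk, map_mul, mk_modByMonicHom hp, mk_modByMonicHom hp,
            mk_modByMonicHom hp, hu, Units.val_mul])
      have e : ∀ a : (AdjoinRoot p)ˣ, liftEntries hp (Function.update u i a) =
          Fin.cons (polyUnit p) (Function.update
            (fun j => polyUnit (AdjoinRoot.modByMonicHom hp.1 (u j : AdjoinRoot p))) i
            (polyUnit (AdjoinRoot.modByMonicHom hp.1 (a : AdjoinRoot p)))) := fun a => by
        unfold liftEntries
        congr 1
        funext j
        exact Function.apply_update (fun _ (a : (AdjoinRoot p)ˣ) =>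
          polyUnit (AdjoinRoot.modByMonicHom hp.1 (a : AdjoinRoot p))) u i a j
      rw [e, e]
      rw [Function.update_eq_self] at h
      exact h)
    (fun u i j hij h => by
      rw [QuotientAddGroup.eq_zero_iff, symbol_eq_zero _ i.succ j.succ (by simpa using hij)]
      · exact zero_mem _
      · simp only [liftEntries, Fin.cons_succ]
        rw [val_polyUnit (modByMonicHom_unit_ne_zero hp _),
          val_polyUnit (modByMonicHom_unit_ne_zero hp _), ← map_add, ← map_add, h,
          ← map_one (AdjoinRoot.mk p), modByMonicHom_mk_of_degree_lt hp, map_one]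
        rw [degree_one]
        exact_mod_cast hp.2.natDegree_pos)

theorem residueSection_symbol (u : Fin n → (AdjoinRoot p)ˣ) :
    residueSection hp (symbol u) =
      (symbol (liftEntries hp u) : MilnorK (n + 1) (RatFunc F) ⧸ _) :=
  lift_symbol _ _ _ _

theorem exists_liftEntries_eq {g : Fin n → F[X]} (hg : ∀ j, g j ≠ 0)
    (hgd : ∀ j, (g j).degree < p.natDegree) :
    ∃ u : Fin n → (AdjoinRoot p)ˣ,
      liftEntries hp u = Fin.cons (polyUnit p) fun j => polyUnit (g j) := by
  have : Fact (Irreducible p) := ⟨hp.2⟩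
  have hne : ∀ j, AdjoinRoot.mk p (g j) ≠ 0 := fun j => by
    rw [Ne, AdjoinRoot.mk_eq_zero]
    exact not_dvd_of_degree_lt hp (hg j) (hgd j)
  refine ⟨fun j => Units.mk0 _ (hne j), ?_⟩
  simp only [liftEntries, Units.val_mk0, modByMonicHom_mk_of_degree_lt hp (hgd _)]

end Residue

/-- The monic irreducible polynomials, indexing the closed points of the affine line. -/
abbrev MonicPrime (F : Type) [Field F] : Type := {p : F[X] // p.Monic ∧ Irreducible p}

/-- The properties of the family of residue maps used in the proof of Milnor's theorem. -/
structure IsResidue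
    (res : ∀ p : MonicPrime F, MilnorK (n + 1) (RatFunc F) →+ MilnorK n (AdjoinRoot p.1)) :
    Prop where
  unit : ∀ (p : MonicPrime F) (g : Fin (n + 1) → F[X]), (∀ j, ¬ p.1 ∣ g j) →
    res p (symbol fun j => polyUnit (g j)) = 0
  liftEntries : ∀ (p : MonicPrime F) (u : Fin n → (AdjoinRoot p.1)ˣ),
    res p (symbol (liftEntries p.2 u)) = symbol u

namespace IsResidue

variable {res : ∀ p : MonicPrime F, MilnorK (n + 1) (RatFunc F) →+ MilnorK n (AdjoinRoot p.1)}
  (hres : IsResidue res)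
include hres

theorem eq_zero_of_mem_filtration (p : MonicPrime F) {d : ℕ} (hd : d ≤ p.1.natDegree)
    {x : MilnorK (n + 1) (RatFunc F)} (hx : x ∈ filtration F (n + 1) d) : res p x = 0 := by
  refine filtration_le (res p).ker (fun g hg hgd => ?_) hx
  exact hres.unit p g fun j => not_dvd_of_degree_lt p.2 (hg j)
    ((hgd j).trans_le (by exact_mod_cast hd))

theorem liftEntries_of_ne {p q : MonicPrime F} (hpq : p ≠ q)
    (hd : p.1.natDegree ≤ q.1.natDegree) (u : Fin n → (AdjoinRoot p.1)ˣ) :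
    res q (symbol (MilnorK.liftEntries p.2 u)) = 0 := by
  have e : MilnorK.liftEntries p.2 u = fun j => polyUnit ((Fin.cons p.1 fun j =>
      AdjoinRoot.modByMonicHom p.2.1 (u j : AdjoinRoot p.1) : Fin (n + 1) → F[X]) j) := by
    funext j
    refine Fin.cases ?_ (fun j => ?_) j <;> simp [MilnorK.liftEntries]
  rw [e]
  refine hres.unit q _ fun j => ?_
  refine Fin.cases ?_ (fun j => ?_) j
  · intro h
    rw [Fin.cons_zero] at h
    exact hpq (Subtype.ext (eq_of_monic_of_associated p.2.1 q.2.1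
      (q.2.2.associated_of_dvd p.2.2 h).symm))
  · rw [Fin.cons_succ]
    exact not_dvd_of_degree_lt q.2 (modByMonicHom_unit_ne_zero p.2 _)
      ((degree_modByMonicHom_lt p.2 _).trans_le (by exact_mod_cast hd))

theorem finite_ne_zero (x : MilnorK (n + 1) (RatFunc F)) : {p | res p x ≠ 0}.Finite := by
  classical
  obtain ⟨d, hx⟩ := exists_mem_filtration x
  let N : AddSubgroup (MilnorK (n + 1) (RatFunc F)) :=
    { carrier := {x | {p | res p x ≠ 0}.Finite}
      zero_mem' := by simp
      add_mem' := fun {a b} ha hb => (ha.union hb).subset fun p hp => by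
        by_contra h
        simp only [Set.mem_union, Set.mem_ofPred_eq, not_or, not_not] at h
        exact hp (by rw [map_add, h.1, h.2, add_zero])
      neg_mem' := fun {a} ha => by simpa using ha }
  refine filtration_le N (fun g hg _ => ?_) hx
  have hfin : ∀ j, {p : MonicPrime F | p.1 ∣ g j}.Finite := fun j => by
    refine ((UniqueFactorizationMonoid.normalizedFactors (g j)).toFinset.finite_toSet.preimage
      Subtype.val_injective.injOn).subset fun p hp => ?_
    simp only [Set.mem_preimage, Finset.mem_coe, Multiset.mem_toFinset]
    exact (UniqueFactorizationMonoid.mem_normalizedFactors_iff' (hg j)).2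
      ⟨p.2.2, p.2.1.normalize_eq_self, hp⟩
  refine (Set.finite_iUnion hfin).subset fun p hp => ?_
  by_contra h
  simp only [Set.mem_iUnion, Set.mem_ofPred_eq, not_exists] at h
  exact hp (hres.unit p g h)

/-- An element of the `d + 1`-st step of the filtration all of whose residues at polynomials of
degree `d` vanish lies in the `d`-th step. -/
theorem mem_filtration_of_mem_succ {d : ℕ} (hd : 1 ≤ d) {x : MilnorK (n + 1) (RatFunc F)}
    (hx : x ∈ filtration F (n + 1) (d + 1))
    (h : ∀ p : MonicPrime F, p.1.natDegree = d → res p x = 0) :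
    x ∈ filtration F (n + 1) d := by
  classical
  have hsec : ∀ p : {p : MonicPrime F // p.1.natDegree = d},
      ∃ s : MilnorK n (AdjoinRoot p.1.1) →+
        MilnorK (n + 1) (RatFunc F) ⧸ filtration F (n + 1) d,
        ∀ u, s (symbol u) = QuotientAddGroup.mk (symbol (MilnorK.liftEntries p.1.2 u)) := by
    rintro ⟨p, hp⟩
    subst hp
    exact ⟨residueSection p.2, residueSection_symbol p.2⟩
  choose s hs using hsec
  let ρ : ∀ p : {p : MonicPrime F // p.1.natDegree = d},
      MilnorK (n + 1) (RatFunc F) ⧸ filtration F (n + 1) d →+ MilnorK n (AdjoinRoot p.1.1) :=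
    fun p => QuotientAddGroup.lift _ (res p.1)
      fun _ hy => hres.eq_zero_of_mem_filtration p.1 p.2.ge hy
  have hρ : ∀ p, (ρ p).comp (DFinsupp.sumAddHom s) = DFinsupp.evalAddMonoidHom p := by
    intro p
    refine DFinsupp.addHom_ext' fun q => hom_ext fun u => ?_
    simp only [AddMonoidHom.comp_apply, DFinsupp.singleAddHom_apply, DFinsupp.sumAddHom_single, hs]
    change res p.1 (symbol _) = (DFinsupp.single q (symbol u) :
      Π₀ p : {p : MonicPrime F // p.1.natDegree = d}, MilnorK n (AdjoinRoot p.1.1)) p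
    rcases eq_or_ne q p with rfl | hqp
    · rw [hres.liftEntries, DFinsupp.single_eq_same]
    · rw [hres.liftEntries_of_ne (fun e => hqp (Subtype.ext e)) (q.2.trans p.2.symm).le,
        DFinsupp.single_eq_of_ne hqp.symm]
  have hle := filtration_succ_le hd
    ((DFinsupp.sumAddHom s).range.comap (QuotientAddGroup.mk' (filtration F (n + 1) d)))
    (fun y hy => ⟨0, by
      rw [map_zero, QuotientAddGroup.mk'_apply, (QuotientAddGroup.eq_zero_iff y).2 hy]⟩)
    (fun p hp hpd g hg hgd => by
      obtain ⟨u, hu⟩ := exists_liftEntries_eq hp hg (by rwa [hpd])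
      exact ⟨DFinsupp.single ⟨⟨p, hp⟩, hpd⟩ (symbol u), by
        rw [DFinsupp.sumAddHom_single, hs, ← hu]
        rfl⟩)
  obtain ⟨y, hy⟩ := hle hx
  have hy0 : y = 0 := by
    ext p
    change DFinsupp.evalAddMonoidHom p y = 0
    rw [← hρ p, AddMonoidHom.comp_apply, hy]
    exact h p.1 p.2
  rw [hy0, map_zero] at hy
  exact (QuotientAddGroup.eq_zero_iff x).1 hy.symm

theorem mem_filtration_one {x : MilnorK (n + 1) (RatFunc F)} (h : ∀ p, res p x = 0) :
    x ∈ filtration F (n + 1) 1 := by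
  obtain ⟨d, hx⟩ := exists_mem_filtration x
  induction d with
  | zero => exact filtration_mono zero_le_one hx
  | succ d ih =>
    rcases Nat.eq_zero_or_pos d with rfl | hd
    · exact hx
    · exact ih (hres.mem_filtration_of_mem_succ hd hx fun p _ => h p)

theorem exists_eq_of_degree_le (p : MonicPrime F) (y : MilnorK n (AdjoinRoot p.1)) :
    ∃ x, res p x = y ∧ ∀ q, q ≠ p → p.1.natDegree ≤ q.1.natDegree → res q x = 0 := by
  let N : AddSubgroup (MilnorK (n + 1) (RatFunc F)) :=
    ⨅ q : {q : MonicPrime F // q ≠ p ∧ p.1.natDegree ≤ q.1.natDegree}, (res q.1).ker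
  have := mem_of_forall_symbol_mem (N.map (res p)) (fun u =>
    ⟨symbol (MilnorK.liftEntries p.2 u), AddSubgroup.mem_iInf.2 fun q =>
      hres.liftEntries_of_ne q.2.1.symm q.2.2 u, hres.liftEntries p u⟩) y
  obtain ⟨x, hx, rfl⟩ := this
  exact ⟨x, rfl, fun q hq hd => AddSubgroup.mem_iInf.1 hx ⟨q, hq, hd⟩⟩

open Classical in
theorem exists_eq_single (p : MonicPrime F) (y : MilnorK n (AdjoinRoot p.1)) :
    ∃ x, ∀ q, res q x = (Pi.single p y : ∀ q : MonicPrime F, MilnorK n (AdjoinRoot q.1)) q := by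
  induction hd : p.1.natDegree using Nat.strong_induction_on generalizing p with
  | _ d ih =>
  obtain ⟨x, hx, hx0⟩ := hres.exists_eq_of_degree_le p y
  have hlt : ∀ q, q ≠ p → res q x ≠ 0 → q.1.natDegree < d := fun q hq hqx => by
    by_contra h
    exact hqx (hx0 q hq (by omega))
  have hz : ∀ q, ∃ z, q ≠ p → ∀ r,
      res r z = (Pi.single q (res q x) : ∀ q : MonicPrime F, MilnorK n (AdjoinRoot q.1)) r := by
    intro q
    by_cases hq : q ≠ p
    · by_cases hqx : res q x = 0
      · exact ⟨0, fun _ r => by simp [hqx]⟩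
      · obtain ⟨z, hz⟩ := ih _ (hlt q hq hqx) q (res q x) rfl
        exact ⟨z, fun _ => hz⟩
    · exact ⟨0, fun h => absurd h hq⟩
  choose z hz using hz
  refine ⟨x - ∑ q ∈ (hres.finite_ne_zero x).toFinset.erase p, z q, fun r => ?_⟩
  rw [map_sub, map_sum, Finset.sum_congr rfl fun q hq => hz q (Finset.ne_of_mem_erase hq) r]
  rw [Finset.sum_pi_single]
  rcases eq_or_ne r p with rfl | hr
  · simp [hx]
  · by_cases hrx : res r x = 0 <;> simp [hr, hrx]

theorem exists_eq_of_finite (y : ∀ p : MonicPrime F, MilnorK n (AdjoinRoot p.1))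
    (hy : {p | y p ≠ 0}.Finite) : ∃ x, ∀ p, res p x = y p := by
  classical
  choose x hx using fun p => hres.exists_eq_single p (y p)
  refine ⟨∑ p ∈ hy.toFinset, x p, fun q => ?_⟩
  rw [map_sum, Finset.sum_congr rfl fun p _ => hx p q, Finset.sum_pi_single]
  by_cases h : y q = 0 <;> simp [h]

end IsResidue

/-- Constants generate the first step of the filtration. -/
theorem filtration_one_le_range (i : MilnorK n F →+ MilnorK n (RatFunc F))
    (hi : ∀ (u : Fin n → Fˣ) (w : Fin n → (RatFunc F)ˣ),
      (∀ j, (w j : RatFunc F) = algebraMap F (RatFunc F) (u j)) → i (symbol u) = symbol w) :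
    filtration F n 1 ≤ i.range := by
  refine filtration_le _ fun g hg hgd => ?_
  have hc : ∀ j, ∃ c : Fˣ, g j = C (c : F) := fun j => by
    have e : g j = C ((g j).coeff 0) := eq_C_of_degree_le_zero (by
      rw [← natDegree_eq_zero_iff_degree_le_zero]
      have := (natDegree_lt_iff_degree_lt (hg j)).2 (hgd j)
      omega)
    refine ⟨Units.mk0 ((g j).coeff 0) fun h0 => hg j ?_, e⟩
    rw [e, h0, C_0]
  choose c hc using hc
  refine ⟨symbol c, hi c _ fun j => ?_⟩
  rw [val_polyUnit (hg j), hc j, IsScalarTower.algebraMap_apply F F[X] (RatFunc F)]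
  rfl

end RationalFunctionField

end MilnorK

/-- Milnor's exact sequence for the rational function field.
Let `F` be a field. Monic irreducible polynomials `p ∈ F[t]` index the closed points of
`𝔸¹_F`, with residue fields `κ_p = F[t]/(p)`.  Given the map
`i : K^M_{n+1}(F) → K^M_{n+1}(F(t))` induced by the inclusion `F ⊆ F(t)` (characterized on
symbols) and the residue maps `∂_p : K^M_{n+1}(F(t)) → K^M_n(κ_p)` of the valuations `v_p`
(characterized by `∂_p = 0` on symbols of `v_p`-units and
`∂_p{p, u₂, …, u_{n+1}} = {ū₂, …, ū_{n+1}}` for units `u_j`), the residue maps induce an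
isomorphism `K^M_{n+1}(F(t)) ≅ K^M_{n+1}(F) ⊕ ⊕_p K^M_n(κ_p)`, whose first component is
split by the inclusion `F ⊆ F(t)`. -/
theorem stmt_8 (F : Type) [Field F] (n : ℕ)
    (i : MilnorK (n + 1) F →+ MilnorK (n + 1) (RatFunc F))
    (hi : ∀ (u : Fin (n + 1) → Fˣ) (w : Fin (n + 1) → (RatFunc F)ˣ),
      (∀ j, (w j : RatFunc F) = algebraMap F (RatFunc F) (u j)) →
      i (MilnorK.symbol u) = MilnorK.symbol w)
    (res : ∀ p : {p : Polynomial F // p.Monic ∧ Irreducible p},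
      MilnorK (n + 1) (RatFunc F) →+ MilnorK n (AdjoinRoot p.1))
    (hres₀ : ∀ (p : {p : Polynomial F // p.Monic ∧ Irreducible p})
      (u : Fin (n + 1) → Polynomial F) (w : Fin (n + 1) → (RatFunc F)ˣ),
      (∀ j, ¬ p.1 ∣ u j) →
      (∀ j, (w j : RatFunc F) = algebraMap (Polynomial F) (RatFunc F) (u j)) →
      res p (MilnorK.symbol w) = 0)
    (hresπ : ∀ (p : {p : Polynomial F // p.Monic ∧ Irreducible p})
      (u : Fin n → Polynomial F) (w : Fin (n + 1) → (RatFunc F)ˣ)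
      (wb : Fin n → (AdjoinRoot p.1)ˣ),
      ((w 0 : RatFunc F) = algebraMap (Polynomial F) (RatFunc F) p.1) →
      (∀ j : Fin n, ¬ p.1 ∣ u j) →
      (∀ j : Fin n, (w j.succ : RatFunc F) = algebraMap (Polynomial F) (RatFunc F) (u j)) →
      (∀ j : Fin n, (wb j : AdjoinRoot p.1) = AdjoinRoot.mk p.1 (u j)) →
      res p (MilnorK.symbol w) = MilnorK.symbol wb) :
    ∃ r : MilnorK (n + 1) (RatFunc F) →+ MilnorK (n + 1) F,
      r.comp i = AddMonoidHom.id _ ∧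
      Function.Injective (fun x : MilnorK (n + 1) (RatFunc F) =>
        ((r x, fun p => res p x) :
          MilnorK (n + 1) F × (∀ p : {p : Polynomial F // p.Monic ∧ Irreducible p},
            MilnorK n (AdjoinRoot p.1)))) ∧
      Set.range (fun x : MilnorK (n + 1) (RatFunc F) =>
        ((r x, fun p => res p x) :
          MilnorK (n + 1) F × (∀ p : {p : Polynomial F // p.Monic ∧ Irreducible p},
            MilnorK n (AdjoinRoot p.1)))) =
        {y | {p | y.2 p ≠ 0}.Finite} := by
  have hres : MilnorK.IsResidue res :=
    { unit := fun p g hg => hres₀ p g _ hg fun j =>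
        MilnorK.val_polyUnit fun h => hg j (h ▸ dvd_zero _)
      liftEntries := fun p u => hresπ p
        (fun j => AdjoinRoot.modByMonicHom p.2.1 (u j : AdjoinRoot p.1)) _ u
        (MilnorK.val_polyUnit p.2.1.ne_zero)
        (fun j => MilnorK.not_dvd_of_degree_lt p.2 (MilnorK.modByMonicHom_unit_ne_zero p.2 _)
          (MilnorK.degree_modByMonicHom_lt p.2 _))
        (fun j => MilnorK.val_polyUnit (MilnorK.modByMonicHom_unit_ne_zero p.2 _))
        (fun j => (MilnorK.mk_modByMonicHom p.2 _).symm) }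
  have hirange := MilnorK.filtration_one_le_range i hi
  have hri : (MilnorK.specialization F (n + 1)).comp i = AddMonoidHom.id _ := by
    refine MilnorK.hom_ext fun u => ?_
    rw [AddMonoidHom.comp_apply,
      hi u (fun j => Units.map (algebraMap F (RatFunc F) : F →* RatFunc F) (u j)) fun _ => rfl,
      MilnorK.specialization_symbol, AddMonoidHom.id_apply]
    congr 1
    funext j
    exact Units.ext (MilnorK.ratLeadingCoeff_C _)
  have hri' : ∀ y, MilnorK.specialization F (n + 1) (i y) = y := DFunLike.congr_fun hri
  have hresi : ∀ p y, res p (i y) = 0 := by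
    intro p y
    refine MilnorK.mem_of_forall_symbol_mem ((res p).comp i).ker (fun u => ?_) y
    rw [AddMonoidHom.mem_ker, AddMonoidHom.comp_apply,
      hi u (fun j => MilnorK.polyUnit (Polynomial.C (u j : F)))]
    · refine hres.unit p _ fun j hd => p.2.2.not_isUnit (isUnit_of_dvd_unit hd ?_)
      exact Polynomial.isUnit_C.2 (u j).isUnit
    · intro j
      rw [MilnorK.val_polyUnit (by simp), IsScalarTower.algebraMap_apply F (Polynomial F) (RatFunc F)]
      rfl
  refine ⟨MilnorK.specialization F (n + 1), hri, ?_, ?_⟩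
  · intro x x' hxx'
    obtain ⟨h1, h2⟩ := Prod.mk.inj hxx'
    have hmem := hirange (hres.mem_filtration_one (x := x - x') fun p => by
      rw [map_sub, congrFun h2 p, sub_self])
    obtain ⟨y, hy⟩ := hmem
    have := hri' y
    rw [hy, map_sub, h1, sub_self] at this
    rw [← sub_eq_zero, ← hy, ← this, map_zero]
  · ext ⟨a, y⟩
    constructor
    · rintro ⟨x, hx⟩
      obtain ⟨-, rfl⟩ := Prod.mk.inj hx
      exact hres.finite_ne_zero x
    · intro hy
      obtain ⟨x, hx⟩ := hres.exists_eq_of_finite y hy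
      refine ⟨x + i (a - MilnorK.specialization F (n + 1) x), Prod.ext ?_ (funext fun p => ?_)⟩
      · change MilnorK.specialization F (n + 1) _ = a
        rw [map_add, hri', add_sub_cancel]
      · change res p _ = y p
        rw [map_add, hresi, add_zero, hx]
end
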